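/- Let v be a bounded positive solution of the ODE (O6). Then v'(t) < ((n-6)/2)·v(t) for every t ∈ ℝ. (Under the Emden–Fowler change of variables this is equivalent to the strict radial monotonicity of the corresponding solution of the PDE.) -/

import Mathlib

noncomputable section

open Real

def cN (n : ℕ) : ℝ := (n : ℝ) * ((n : ℝ) - 6) * ((n : ℝ) ^ 4 - 20 * (n : ℝ) ^ 2 + 64) / 64
def K0 (n : ℕ) : ℝ := ((n : ℝ) - 6) ^ 2 * ((n : ℝ) - 2) ^ 2 * ((n : ℝ) + 2) ^ 2 / 64
def K2 (n : ℕ) : ℝ := (3 * (n : ℝ) ^ 4 - 24 * (n : ℝ) ^ 3 + 72 * (n : ℝ) ^ 2 - 96 * (n : ℝ) + 304) / 16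
def K4 (n : ℕ) : ℝ := (3 * (n : ℝ) ^ 2 - 12 * (n : ℝ) + 44) / 4

/-- `v` is a (classical, entire) solution of the sixth order ODE (O6). -/
def IsSolO6 (n : ℕ) (v : ℝ → ℝ) : Prop :=
  ContDiff ℝ 6 v ∧ ∀ t : ℝ,
    iteratedDeriv 6 v t - K4 n * iteratedDeriv 4 v t + K2 n * iteratedDeriv 2 v t
      - K0 n * v t + cN n * |v t| ^ (12 / ((n : ℝ) - 6)) * v t = 0

open Filter

/-- A real function that tends to `±∞` neither at `+∞` nor at `-∞`. -/
structure NonDiverging (y : ℝ → ℝ) : Prop where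
  top_top : ¬ Tendsto y atTop atTop
  top_bot : ¬ Tendsto y atTop atBot
  bot_top : ¬ Tendsto y atBot atTop
  bot_bot : ¬ Tendsto y atBot atBot

lemma le_of_pos_deriv_at_level {y y' : ℝ → ℝ} (hy : ∀ t, HasDerivAt y (y' t) t) {B t₀ : ℝ}
    (h₀ : B ≤ y t₀) (h : ∀ t, t₀ ≤ t → y t = B → 0 < y' t) {t : ℝ} (ht : t₀ ≤ t) : B ≤ y t := by
  have key := image_le_of_deriv_right_lt_deriv_boundary' (a := t₀) (b := t)
    (f := fun s => - y s) (f' := fun s => - y' s) (B := fun _ => -B) (B' := fun _ => 0)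
    (fun s _ => (hy s).neg.continuousAt.continuousWithinAt)
    (fun s _ => (hy s).neg.hasDerivWithinAt) (by simpa using h₀) continuousOn_const
    (fun s _ => hasDerivWithinAt_const _ _ _)
    (fun s hs e => by simpa using h s hs.1 (by simpa using e))
  simpa using key (Set.right_mem_Icc.2 ht)

lemma tendsto_atTop_or_atBot_of_forcing_atTop {y g : ℝ → ℝ} {r : ℝ}
    (hy : ∀ t, HasDerivAt y (r * y t + g t) t) (hg : Tendsto g atTop atTop) :
    Tendsto y atTop atTop ∨ Tendsto y atTop atBot := by
  by_cases hbot : Tendsto y atTop atBot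
  · exact Or.inr hbot
  left
  rw [tendsto_atBot] at hbot
  push Not at hbot
  obtain ⟨b, hb⟩ := hbot
  rw [tendsto_atTop]
  intro c
  set M := max |b| |c| with hM
  have hbM : |b| ≤ M := le_max_left _ _
  have hcM : |c| ≤ M := le_max_right _ _
  obtain ⟨T, hT⟩ := eventually_atTop.1 (tendsto_atTop.1 hg (|r| * M + 1))
  have hderiv : ∀ t, T ≤ t → |y t| ≤ M → 1 ≤ r * y t + g t := by
    intro t ht hyt
    have h1 : |r * y t| ≤ |r| * M := by
      rw [abs_mul]; exact mul_le_mul_of_nonneg_left hyt (abs_nonneg _)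
    linarith [hT t ht, neg_abs_le (r * y t)]
  have hM0 : 0 ≤ M := (abs_nonneg _).trans hbM
  obtain ⟨t₀, ht₀, hyt₀⟩ := frequently_atTop.1 hb T
  have hlow : ∀ t, t₀ ≤ t → -M ≤ y t := fun t ht =>
    le_of_pos_deriv_at_level hy (by linarith [neg_abs_le b])
      (fun s hs e => lt_of_lt_of_le one_pos
        (hderiv s (ht₀.trans hs) (by rw [e, abs_neg, abs_of_nonneg hM0]))) ht
  obtain ⟨t₁, ht₁, hyt₁⟩ : ∃ t₁, t₀ ≤ t₁ ∧ M ≤ y t₁ := by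
    by_contra! hlt
    have hgrow := Convex.mul_sub_le_image_sub_of_le_deriv (convex_Ici t₀) (f := y) (C := 1)
      (fun s _ => (hy s).continuousAt.continuousWithinAt)
      (fun s _ => (hy s).differentiableAt.differentiableWithinAt)
      (fun s hs => by
        have hs' : t₀ ≤ s := interior_subset hs
        rw [(hy s).deriv]
        exact hderiv s (ht₀.trans hs') (abs_le.2 ⟨hlow s hs', (hlt s hs').le⟩))
      t₀ Set.self_mem_Ici (t₀ + 2 * M) (by simp; linarith) (by linarith)
    linarith [hlow t₀ le_rfl, hlt (t₀ + 2 * M) (by linarith)]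
  filter_upwards [eventually_ge_atTop t₁] with t ht
  have : M ≤ y t := le_of_pos_deriv_at_level hy hyt₁
      (fun s hs e => lt_of_lt_of_le one_pos
        (hderiv s (ht₀.trans (ht₁.trans hs)) (by rw [e, abs_of_nonneg hM0]))) ht
  linarith [le_abs_self c]

lemma NonDiverging.neg {y : ℝ → ℝ} (h : NonDiverging y) : NonDiverging (fun t => - y t) where
  top_top := by simpa only [tendsto_neg_atTop_iff] using h.top_bot
  top_bot := by simpa only [tendsto_neg_atBot_iff] using h.top_top
  bot_top := by simpa only [tendsto_neg_atTop_iff] using h.bot_bot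
  bot_bot := by simpa only [tendsto_neg_atBot_iff] using h.bot_top

lemma NonDiverging.comp_neg {y : ℝ → ℝ} (h : NonDiverging y) :
    NonDiverging (fun t => y (-t)) where
  top_top := fun H => h.bot_top (by simpa [Function.comp_def] using H.comp tendsto_neg_atBot_atTop)
  top_bot := fun H => h.bot_bot (by simpa [Function.comp_def] using H.comp tendsto_neg_atBot_atTop)
  bot_top := fun H => h.top_top (by simpa [Function.comp_def] using H.comp tendsto_neg_atTop_atBot)
  bot_bot := fun H => h.top_bot (by simpa [Function.comp_def] using H.comp tendsto_neg_atTop_atBot)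

lemma NonDiverging.not_tendsto_forcing {y g : ℝ → ℝ} {r : ℝ} (h : NonDiverging y)
    (hy : ∀ t, HasDerivAt y (r * y t + g t) t) : ¬ Tendsto g atTop atTop := fun hg =>
  (tendsto_atTop_or_atBot_of_forcing_atTop hy hg).elim h.top_top h.top_bot

/-- If `y` does not diverge, neither does `(D - r) y`. -/
lemma NonDiverging.forcing {y g : ℝ → ℝ} {r : ℝ} (h : NonDiverging y)
    (hy : ∀ t, HasDerivAt y (r * y t + g t) t) : NonDiverging g := by
  have hneg : ∀ t, HasDerivAt (fun t => - y t) (r * (- y t) + - g t) t := fun t => by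
    refine HasDerivAt.congr_deriv ((hy t).neg) ?_; ring
  have hrefl : ∀ t, HasDerivAt (fun t => y (-t)) (-r * y (-t) + - g (-t)) t := fun t => by
    refine HasDerivAt.congr_deriv ((hy (-t)).scomp t (hasDerivAt_neg t)) ?_; simp; ring
  have hboth : ∀ t, HasDerivAt (fun t => - y (-t)) (-r * (- y (-t)) + g (-t)) t := fun t => by
    refine HasDerivAt.congr_deriv ((hrefl t).neg) ?_; ring
  refine ⟨h.not_tendsto_forcing hy, fun H => h.neg.not_tendsto_forcing hneg ?_,
    fun H => h.comp_neg.neg.not_tendsto_forcing hboth (H.comp tendsto_neg_atTop_atBot),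
    fun H => h.comp_neg.not_tendsto_forcing hrefl ?_⟩
  · exact tendsto_neg_atBot_atTop.comp H
  · exact tendsto_neg_atBot_atTop.comp (H.comp tendsto_neg_atTop_atBot)

/-- For `r > 0`, a nondiverging `y` with `(D - r) y > 0` is negative. -/
lemma NonDiverging.neg_of_pos_forcing {y g : ℝ → ℝ} {r : ℝ} (h : NonDiverging y) (hr : 0 < r)
    (hy : ∀ t, HasDerivAt y (r * y t + g t) t) (hg : ∀ t, 0 < g t) (t : ℝ) : y t < 0 := by
  by_contra! ht
  have hd : ∀ s, HasDerivAt (fun s => exp (-r * s) * y s) (exp (-r * s) * g s) s := fun s => by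
    have h1 : HasDerivAt (fun s : ℝ => exp (-r * s)) (exp (-r * s) * (-r)) s := by
      simpa using ((hasDerivAt_id s).const_mul (-r)).exp
    refine HasDerivAt.congr_deriv (h1.mul (hy s)) ?_; ring
  have hmono : StrictMono (fun s => exp (-r * s) * y s) :=
    strictMono_of_deriv_pos fun s => by
      rw [(hd s).deriv]; exact mul_pos (exp_pos _) (hg s)
  set δ := exp (-r * (t + 1)) * y (t + 1) with hδ
  have hδ0 : 0 < δ :=
    (mul_nonneg (exp_pos (-r * t)).le ht).trans_lt (hmono (lt_add_one t))
  refine h.top_top (tendsto_atTop_mono' (f₁ := fun s => δ * exp (r * s)) _ ?_ ?_)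
  · filter_upwards [eventually_ge_atTop (t + 1)] with s hs
    have h1 : δ ≤ exp (-r * s) * y s := hmono.monotone hs
    have h2 := mul_le_mul_of_nonneg_right h1 (exp_pos (r * s)).le
    have h3 : exp (-r * s) * exp (r * s) = 1 := by rw [← exp_add]; simp
    linear_combination h2 + y s * h3
  · exact (tendsto_exp_atTop.comp (tendsto_id.const_mul_atTop hr)).const_mul_atTop hδ0

lemma NonDiverging.pos_of_neg_forcing {y g : ℝ → ℝ} {r : ℝ} (h : NonDiverging y) (hr : 0 < r)
    (hy : ∀ t, HasDerivAt y (r * y t + g t) t) (hg : ∀ t, g t < 0) (t : ℝ) : 0 < y t := by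
  have := h.neg.neg_of_pos_forcing hr (g := fun t => - g t)
    (fun t => by refine HasDerivAt.congr_deriv ((hy t).neg) ?_; ring) (fun t => by linarith [hg t]) t
  linarith

/-- For `r > 0`, a nondiverging `y` with `(D + r) y < 0` is negative. -/
lemma NonDiverging.neg_of_neg_forcing {y g : ℝ → ℝ} {r : ℝ} (h : NonDiverging y) (hr : 0 < r)
    (hy : ∀ t, HasDerivAt y (-r * y t + g t) t) (hg : ∀ t, g t < 0) (t : ℝ) : y t < 0 := by
  have := h.comp_neg.neg_of_pos_forcing hr (g := fun t => - g (-t))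
    (fun t => by refine HasDerivAt.congr_deriv ((hy (-t)).scomp t (hasDerivAt_neg t)) ?_; simp; ring)
    (fun t => by linarith [hg (-t)]) (-t)
  simpa using this

lemma NonDiverging.pos_of_pos_forcing {y g : ℝ → ℝ} {r : ℝ} (h : NonDiverging y) (hr : 0 < r)
    (hy : ∀ t, HasDerivAt y (-r * y t + g t) t) (hg : ∀ t, 0 < g t) (t : ℝ) : 0 < y t := by
  have := h.neg.neg_of_neg_forcing hr (g := fun t => - g t)
    (fun t => by refine HasDerivAt.congr_deriv ((hy t).neg) ?_; ring) (fun t => by linarith [hg t]) t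
  linarith

lemma nonDiverging_of_bounded {y : ℝ → ℝ} {M : ℝ} (hM : ∀ t, |y t| ≤ M) : NonDiverging y := by
  have hup : ∀ l : Filter ℝ, l.NeBot → ¬ Tendsto y l atTop := fun l _ H => by
    obtain ⟨t, ht⟩ := (H.eventually_gt_atTop M).exists
    linarith [le_abs_self (y t), hM t]
  have hdown : ∀ l : Filter ℝ, l.NeBot → ¬ Tendsto y l atBot := fun l _ H => by
    obtain ⟨t, ht⟩ := (H.eventually_lt_atBot (-M)).exists
    linarith [neg_abs_le (y t), hM t]
  exact ⟨hup _ inferInstance, hdown _ inferInstance, hup _ inferInstance, hdown _ inferInstance⟩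

/-- If `(D² - a²)(D² - b²)(D² - c²) v < 0` for a nondiverging `v`, then `(D - a) v < 0`;
the function `d k` is the `k`-th derivative of `v`. -/
lemma deriv_lt_of_sixth_order_neg {d : ℕ → ℝ → ℝ} {a b c : ℝ} (ha : 0 < a) (hb : 0 < b)
    (hc : 0 < c) (hd : ∀ k < 6, ∀ t, HasDerivAt (d k) (d (k + 1) t) t)
    (h₀ : NonDiverging (d 0))
    (hneg : ∀ t, d 6 t - (a ^ 2 + b ^ 2 + c ^ 2) * d 4 t
      + (a ^ 2 * b ^ 2 + a ^ 2 * c ^ 2 + b ^ 2 * c ^ 2) * d 2 t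
      - a ^ 2 * b ^ 2 * c ^ 2 * d 0 t < 0) (t : ℝ) : d 1 t < a * d 0 t := by
  have d0 := hd 0 (by norm_num)
  have d1 := hd 1 (by norm_num)
  have d2 := hd 2 (by norm_num)
  have d3 := hd 3 (by norm_num)
  have d4 := hd 4 (by norm_num)
  have d5 := hd 5 (by norm_num)
  norm_num at d0 d1 d2 d3 d4 d5
  let u₁ : ℝ → ℝ := fun t => d 1 t - a * d 0 t
  let u₂ : ℝ → ℝ := fun t => d 2 t - a ^ 2 * d 0 t
  let u₃ : ℝ → ℝ := fun t => (d 3 t - a ^ 2 * d 1 t) - b * (d 2 t - a ^ 2 * d 0 t)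
  let u₄ : ℝ → ℝ := fun t => d 4 t - (a ^ 2 + b ^ 2) * d 2 t + a ^ 2 * b ^ 2 * d 0 t
  let u₅ : ℝ → ℝ := fun t => (d 5 t - (a ^ 2 + b ^ 2) * d 3 t + a ^ 2 * b ^ 2 * d 1 t)
    - c * (d 4 t - (a ^ 2 + b ^ 2) * d 2 t + a ^ 2 * b ^ 2 * d 0 t)
  have e₀ : ∀ t, HasDerivAt (d 0) (a * d 0 t + u₁ t) t := fun t => by
    refine HasDerivAt.congr_deriv (d0 t) ?_; simp only [u₁]; ring
  have e₁ : ∀ t, HasDerivAt u₁ (-a * u₁ t + u₂ t) t := fun t => by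
    refine HasDerivAt.congr_deriv ((d1 t).sub ((d0 t).const_mul a)) ?_; simp only [u₁, u₂]; ring
  have e₂ : ∀ t, HasDerivAt u₂ (b * u₂ t + u₃ t) t := fun t => by
    refine HasDerivAt.congr_deriv ((d2 t).sub ((d0 t).const_mul (a ^ 2))) ?_; simp only [u₂, u₃]; ring
  have e₃ : ∀ t, HasDerivAt u₃ (-b * u₃ t + u₄ t) t := fun t => by
    refine HasDerivAt.congr_deriv (((d3 t).sub ((d1 t).const_mul (a ^ 2))).sub
      (((d2 t).sub ((d0 t).const_mul (a ^ 2))).const_mul b)) ?_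
    simp only [u₃, u₄]; ring
  have e₄ : ∀ t, HasDerivAt u₄ (c * u₄ t + u₅ t) t := fun t => by
    refine HasDerivAt.congr_deriv (((d4 t).sub ((d2 t).const_mul (a ^ 2 + b ^ 2))).add
      ((d0 t).const_mul (a ^ 2 * b ^ 2))) ?_
    simp only [u₄, u₅]; ring
  have e₅ : ∀ t, HasDerivAt u₅ (-c * u₅ t + (d 6 t - (a ^ 2 + b ^ 2 + c ^ 2) * d 4 t
      + (a ^ 2 * b ^ 2 + a ^ 2 * c ^ 2 + b ^ 2 * c ^ 2) * d 2 t
      - a ^ 2 * b ^ 2 * c ^ 2 * d 0 t)) t := fun t => by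
    refine HasDerivAt.congr_deriv ((((d5 t).sub ((d3 t).const_mul (a ^ 2 + b ^ 2))).add
      ((d1 t).const_mul (a ^ 2 * b ^ 2))).sub
      ((((d4 t).sub ((d2 t).const_mul (a ^ 2 + b ^ 2))).add
      ((d0 t).const_mul (a ^ 2 * b ^ 2))).const_mul c)) ?_
    simp only [u₅]; ring
  have n₁ := h₀.forcing e₀
  have n₂ := n₁.forcing e₁
  have n₃ := n₂.forcing e₂
  have n₄ := n₃.forcing e₃
  have n₅ := n₄.forcing e₄
  have s₅ := n₅.neg_of_neg_forcing hc e₅ hneg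
  have s₄ := n₄.pos_of_neg_forcing hc e₄ s₅
  have s₃ := n₃.pos_of_pos_forcing hb e₃ s₄
  have s₂ := n₂.neg_of_pos_forcing hb e₂ s₃
  exact sub_neg.1 (n₁.neg_of_neg_forcing ha e₁ s₂ t)

lemma cN_pos {n : ℕ} (hn : 7 ≤ n) : 0 < cN n := by
  have h : (7 : ℝ) ≤ n := by exact_mod_cast hn
  have h1 : (0 : ℝ) < (n : ℝ) ^ 4 - 20 * (n : ℝ) ^ 2 + 64 := by
    nlinarith [mul_pos (show (0 : ℝ) < (n : ℝ) ^ 2 - 4 by nlinarith)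
      (show (0 : ℝ) < (n : ℝ) ^ 2 - 16 by nlinarith)]
  have h2 : (0 : ℝ) < (n : ℝ) - 6 := by linarith
  unfold cN
  positivity

theorem derivative_bound_for_bounded_positive_solutions
    (n : ℕ) (hn : 7 ≤ n) (v : ℝ → ℝ) (hv : IsSolO6 n v)
    (hb : ∃ M : ℝ, ∀ t : ℝ, |v t| ≤ M) (hpos : ∀ t : ℝ, 0 < v t) :
    ∀ t : ℝ, deriv v t < (((n : ℝ) - 6) / 2) * v t := by
  intro t
  obtain ⟨hsmooth, hode⟩ := hv
  obtain ⟨M, hM⟩ := hb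
  have hn' : (7 : ℝ) ≤ n := by exact_mod_cast hn
  have hd : ∀ k < 6, ∀ t, HasDerivAt (iteratedDeriv k v) (iteratedDeriv (k + 1) v t) t := by
    intro k hk t
    rw [iteratedDeriv_succ]
    exact (hsmooth.differentiable_iteratedDeriv k (by exact_mod_cast hk) t).hasDerivAt
  have key := deriv_lt_of_sixth_order_neg (d := fun k => iteratedDeriv k v)
    (a := ((n : ℝ) - 6) / 2) (b := ((n : ℝ) - 2) / 2) (c := ((n : ℝ) + 2) / 2)
    (by linarith) (by linarith) (by linarith) hd
    (by simpa only [iteratedDeriv_zero] using nonDiverging_of_bounded hM)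
    (fun s => by
      have h1 := hode s
      have h2 : 0 < cN n * |v s| ^ (12 / ((n : ℝ) - 6)) * v s :=
        mul_pos (mul_pos (cN_pos hn) (rpow_pos_of_pos (abs_pos.2 (hpos s).ne') _)) (hpos s)
      simp only [iteratedDeriv_zero]
      simp only [K4, K2, K0] at h1
      linear_combination h1 + h2) t
  simpa only [iteratedDeriv_one, iteratedDeriv_zero] using key
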